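/- arXiv:math/0501453 — 4 statements merged into one kernel-verified Lean document; each statement's English description precedes it below -/
import Mathlib

section
/- Let n and m be integers with 0 < m < n. Set b = (n(n+m)/(2m²))^{1/3}, r = √(n(n+2m))/(√2·b·m), q² = (n−m)/n and p² = (n²−m²)/(n(n+2m)) (so 0 ≤ p² < 1). Then (√2·m·b·π/3) · ∫₀^{4K(p)/r} b·(1 − q²·sn(r·x)²) dx = (4π√n/(3√(n+2m))) · ((n+2m)·E(p) − m·K(p)). (This is the computation of the area of the minimal Lagrangian Klein bottle K_{n,m} of ℂP², Proposition 5.3(2): the left-hand side is the integral of the conformal factor e^{2u(x)} = b(1 − q² sn²(rx)) over the fundamental domain.) -/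
/-- The complete elliptic integral of the first kind,
`K(p) = ∫₀^{π/2} dθ/√(1 − p² sin²θ)`. -/
noncomputable def ellipticK (p : ℝ) : ℝ :=
  ∫ θ in (0:ℝ)..(Real.pi / 2), 1 / Real.sqrt (1 - p ^ 2 * Real.sin θ ^ 2)

/-- The complete elliptic integral of the second kind,
`E(p) = ∫₀^{π/2} √(1 − p² sin²θ) dθ`. -/
noncomputable def ellipticE (p : ℝ) : ℝ :=
  ∫ θ in (0:ℝ)..(Real.pi / 2), Real.sqrt (1 - p ^ 2 * Real.sin θ ^ 2)

/-- `sn`, `cn`, `dn` are the Jacobi elliptic functions of modulus `p`: the (unique) global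
solution of the system `sn' = cn·dn`, `cn' = −sn·dn`, `dn' = −p²·sn·cn` with
`sn 0 = 0`, `cn 0 = 1`, `dn 0 = 1`. -/
structure IsJacobiSystem (p : ℝ) (sn cn dn : ℝ → ℝ) : Prop where
  sn_zero : sn 0 = 0
  cn_zero : cn 0 = 1
  dn_zero : dn 0 = 1
  hasDerivAt_sn : ∀ x : ℝ, HasDerivAt sn (cn x * dn x) x
  hasDerivAt_cn : ∀ x : ℝ, HasDerivAt cn (-(sn x * dn x)) x
  hasDerivAt_dn : ∀ x : ℝ, HasDerivAt dn (-(p ^ 2 * sn x * cn x)) x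

/-- A function of `sin²` integrates over a full period to four times its integral over a quarter
period. -/
theorem integral_comp_sin_sq_zero_two_pi {g : ℝ → ℝ}
    (hg : Continuous fun θ : ℝ => g (Real.sin θ ^ 2)) :
    ∫ θ in (0:ℝ)..(2 * Real.pi), g (Real.sin θ ^ 2) =
      4 * ∫ θ in (0:ℝ)..(Real.pi / 2), g (Real.sin θ ^ 2) := by
  have hint (a c : ℝ) :
      IntervalIntegrable (fun θ : ℝ => g (Real.sin θ ^ 2)) MeasureTheory.volume a c :=
    hg.intervalIntegrable a c
  have hreflect : ∫ θ in (Real.pi / 2)..Real.pi, g (Real.sin θ ^ 2) =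
      ∫ θ in (0:ℝ)..(Real.pi / 2), g (Real.sin θ ^ 2) := by
    have h := intervalIntegral.integral_comp_sub_left (a := 0) (b := Real.pi / 2)
      (fun θ : ℝ => g (Real.sin θ ^ 2)) Real.pi
    simp only [Real.sin_pi_sub, sub_zero] at h
    rw [h]
    congr 1
    ring
  have hshift : ∫ θ in Real.pi..(2 * Real.pi), g (Real.sin θ ^ 2) =
      ∫ θ in (0:ℝ)..Real.pi, g (Real.sin θ ^ 2) := by
    have h := intervalIntegral.integral_comp_add_right (a := 0) (b := Real.pi)
      (fun θ : ℝ => g (Real.sin θ ^ 2)) Real.pi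
    simp only [Real.sin_add_pi, neg_sq, zero_add] at h
    rw [h, two_mul]
  have h₁ := intervalIntegral.integral_add_adjacent_intervals
    (hint 0 (Real.pi / 2)) (hint (Real.pi / 2) Real.pi)
  have h₂ := intervalIntegral.integral_add_adjacent_intervals
    (hint 0 Real.pi) (hint Real.pi (2 * Real.pi))
  linarith

theorem one_sub_mul_sin_sq_pos {p : ℝ} (hp : p ^ 2 < 1) (θ : ℝ) :
    0 < 1 - p ^ 2 * Real.sin θ ^ 2 := by
  nlinarith [Real.sin_sq_le_one θ, sq_nonneg (Real.sin θ), sq_nonneg p]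

theorem continuous_one_div_sqrt_one_sub_mul_sin_sq {p : ℝ} (hp : p ^ 2 < 1) :
    Continuous fun θ : ℝ => 1 / Real.sqrt (1 - p ^ 2 * Real.sin θ ^ 2) :=
  continuous_const.div (by fun_prop)
    fun θ => (Real.sqrt_pos.2 (one_sub_mul_sin_sq_pos hp θ)).ne'

theorem integral_zero_two_pi_eq_four_mul_ellipticK {p : ℝ} (hp : p ^ 2 < 1) :
    ∫ θ in (0:ℝ)..(2 * Real.pi), 1 / Real.sqrt (1 - p ^ 2 * Real.sin θ ^ 2) =
      4 * ellipticK p :=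
  integral_comp_sin_sq_zero_two_pi (g := fun s => 1 / Real.sqrt (1 - p ^ 2 * s))
    (continuous_one_div_sqrt_one_sub_mul_sin_sq hp)

theorem integral_zero_two_pi_eq_four_mul_ellipticE (p : ℝ) :
    ∫ θ in (0:ℝ)..(2 * Real.pi), Real.sqrt (1 - p ^ 2 * Real.sin θ ^ 2) =
      4 * ellipticE p :=
  integral_comp_sin_sq_zero_two_pi (g := fun s => Real.sqrt (1 - p ^ 2 * s)) (by fun_prop)

/-- A positive continuous function has an injective primitive. -/
theorem eq_of_integral_eq_of_pos {h : ℝ → ℝ} (hc : Continuous h) (hpos : ∀ x, 0 < h x)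
    {a x y : ℝ} (hxy : (∫ t in a..x, h t) = ∫ t in a..y, h t) : x = y := by
  have key {u v : ℝ} (huv : u < v) : (∫ t in a..u, h t) < ∫ t in a..v, h t := by
    have h₁ := intervalIntegral.intervalIntegral_pos_of_pos (hc.intervalIntegrable u v) hpos huv
    have h₂ := intervalIntegral.integral_add_adjacent_intervals
      (μ := MeasureTheory.volume) (hc.intervalIntegrable a u) (hc.intervalIntegrable u v)
    linarith
  rcases lt_trichotomy x y with hlt | heq | hgt
  · exact absurd hxy (key hlt).ne
  · exact heq
  · exact absurd hxy (key hgt).ne'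

namespace IsJacobiSystem

variable {p : ℝ} {sn cn dn : ℝ → ℝ}

theorem continuous_sn (hJ : IsJacobiSystem p sn cn dn) : Continuous sn :=
  continuous_iff_continuousAt.2 fun x => (hJ.hasDerivAt_sn x).continuousAt

theorem continuous_dn (hJ : IsJacobiSystem p sn cn dn) : Continuous dn :=
  continuous_iff_continuousAt.2 fun x => (hJ.hasDerivAt_dn x).continuousAt

theorem sn_sq_add_cn_sq (hJ : IsJacobiSystem p sn cn dn) (x : ℝ) :
    sn x ^ 2 + cn x ^ 2 = 1 := by
  have hderiv (y : ℝ) : HasDerivAt (fun t => sn t ^ 2 + cn t ^ 2) 0 y := by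
    refine HasDerivAt.congr_deriv (((hJ.hasDerivAt_sn y).pow 2).add ((hJ.hasDerivAt_cn y).pow 2)) ?_
    push_cast
    ring
  have h := is_const_of_deriv_eq_zero (fun y => (hderiv y).differentiableAt)
    (fun y => (hderiv y).deriv) x 0
  simpa [hJ.sn_zero, hJ.cn_zero] using h

theorem dn_sq_add (hJ : IsJacobiSystem p sn cn dn) (x : ℝ) :
    dn x ^ 2 + p ^ 2 * sn x ^ 2 = 1 := by
  have hderiv (y : ℝ) : HasDerivAt (fun t => dn t ^ 2 + p ^ 2 * sn t ^ 2) 0 y := by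
    refine HasDerivAt.congr_deriv (((hJ.hasDerivAt_dn y).pow 2).add
      (((hJ.hasDerivAt_sn y).pow 2).const_mul (p ^ 2))) ?_
    push_cast
    ring
  have h := is_const_of_deriv_eq_zero (fun y => (hderiv y).differentiableAt)
    (fun y => (hderiv y).deriv) x 0
  simpa [hJ.sn_zero, hJ.dn_zero] using h

theorem dn_ne_zero (hJ : IsJacobiSystem p sn cn dn) (hp : p ^ 2 < 1) (x : ℝ) : dn x ≠ 0 := by
  intro h
  have h₁ := hJ.dn_sq_add x
  rw [h] at h₁
  nlinarith [hJ.sn_sq_add_cn_sq x, sq_nonneg (cn x), sq_nonneg p]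

theorem dn_pos (hJ : IsJacobiSystem p sn cn dn) (hp : p ^ 2 < 1) (x : ℝ) : 0 < dn x := by
  by_contra! hx
  obtain ⟨y, hy⟩ := mem_range_of_exists_le_of_exists_ge hJ.continuous_dn ⟨x, hx⟩
    ⟨0, hJ.dn_zero ▸ zero_le_one⟩
  exact hJ.dn_ne_zero hp y hy

/-- There is an amplitude function: a primitive of `dn` whose sine is `sn`. -/
theorem exists_amplitude (hJ : IsJacobiSystem p sn cn dn) :
    ∃ am : ℝ → ℝ, am 0 = 0 ∧ (∀ x, HasDerivAt am (dn x) x) ∧ ∀ x, Real.sin (am x) = sn x := by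
  have ham (y : ℝ) : HasDerivAt (fun x => ∫ t in (0:ℝ)..x, dn t) (dn y) y :=
    (hJ.continuous_dn.integral_hasStrictDerivAt 0 y).hasDerivAt
  obtain ⟨am, hzero, ham⟩ : ∃ am : ℝ → ℝ, am 0 = 0 ∧ ∀ x, HasDerivAt am (dn x) x :=
    ⟨_, intervalIntegral.integral_same, ham⟩
  refine ⟨am, hzero, ham, fun x => ?_⟩
  have hderiv (y : ℝ) : HasDerivAt
      (fun t => (sn t - Real.sin (am t)) ^ 2 + (cn t - Real.cos (am t)) ^ 2) 0 y := by
    refine HasDerivAt.congr_deriv ((((hJ.hasDerivAt_sn y).sub (ham y).sin).pow 2).add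
      (((hJ.hasDerivAt_cn y).sub (ham y).cos).pow 2)) ?_
    simp only [Pi.sub_apply]
    push_cast
    ring
  have h := is_const_of_deriv_eq_zero (fun y => (hderiv y).differentiableAt)
    (fun y => (hderiv y).deriv) x 0
  simp only [hJ.sn_zero, hJ.cn_zero, hzero, Real.sin_zero, Real.cos_zero] at h
  nlinarith [sq_nonneg (sn x - Real.sin (am x)), sq_nonneg (cn x - Real.cos (am x))]

/-- The integral of `dn²` over a full period. -/
theorem integral_dn_sq (hJ : IsJacobiSystem p sn cn dn) (hp : p ^ 2 < 1) :
    ∫ x in (0:ℝ)..(4 * ellipticK p), dn x ^ 2 = 4 * ellipticE p := by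
  obtain ⟨am, hzero, ham, hsin⟩ := hJ.exists_amplitude
  have hsqrt (x : ℝ) : Real.sqrt (1 - p ^ 2 * Real.sin (am x) ^ 2) = dn x := by
    rw [hsin, ← hJ.dn_sq_add x, add_sub_cancel_right, Real.sqrt_sq (hJ.dn_pos hp x).le]
  have hK := continuous_one_div_sqrt_one_sub_mul_sin_sq hp
  have hinv (x : ℝ) :
      ∫ θ in (0:ℝ)..am x, 1 / Real.sqrt (1 - p ^ 2 * Real.sin θ ^ 2) = x := by
    have h := intervalIntegral.integral_comp_mul_deriv (a := 0) (b := x)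
      (fun y _ => ham y) hJ.continuous_dn.continuousOn hK
    simpa [hsqrt, hJ.dn_ne_zero hp, hzero] using h.symm
  have ham_period : am (4 * ellipticK p) = 2 * Real.pi :=
    eq_of_integral_eq_of_pos (a := 0) hK
      (fun θ => one_div_pos.2 (Real.sqrt_pos.2 (one_sub_mul_sin_sq_pos hp θ)))
      ((hinv _).trans (integral_zero_two_pi_eq_four_mul_ellipticK hp).symm)
  have h := intervalIntegral.integral_comp_mul_deriv (a := 0) (b := 4 * ellipticK p)
    (g := fun θ => Real.sqrt (1 - p ^ 2 * Real.sin θ ^ 2))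
    (fun y _ => ham y) hJ.continuous_dn.continuousOn (by fun_prop)
  rw [ham_period, hzero, integral_zero_two_pi_eq_four_mul_ellipticE] at h
  simpa [hsqrt, ← sq] using h

/-- The integral of `p² sn²` over a full period. -/
theorem integral_sn_sq (hJ : IsJacobiSystem p sn cn dn) (hp : p ^ 2 < 1) :
    p ^ 2 * ∫ x in (0:ℝ)..(4 * ellipticK p), sn x ^ 2 = 4 * ellipticK p - 4 * ellipticE p := by
  have hint : IntervalIntegrable (fun x => dn x ^ 2) MeasureTheory.volume 0 (4 * ellipticK p) :=
    (hJ.continuous_dn.pow 2).intervalIntegrable _ _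
  rw [← intervalIntegral.integral_const_mul]
  calc ∫ x in (0:ℝ)..(4 * ellipticK p), p ^ 2 * sn x ^ 2
      = ∫ x in (0:ℝ)..(4 * ellipticK p), (1 - dn x ^ 2) := by
        congr 1
        ext x
        linarith [hJ.dn_sq_add x]
    _ = 4 * ellipticK p - 4 * ellipticE p := by
        rw [intervalIntegral.integral_sub intervalIntegrable_const hint, hJ.integral_dn_sq hp]
        simp

end IsJacobiSystem

/-- Proposition 5.3(2): the area of the minimal Lagrangian Klein bottle `K_{n,m}` of `ℂP²`,
computed as the integral of the conformal factor `e^{2u(x)} = b(1 − q² sn²(rx))`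
over the fundamental domain. -/
theorem area_of_Klein_bottle (n m : ℤ) (hm : 0 < m) (hmn : m < n)
    (b r q p : ℝ)
    (hb : b = (((n : ℝ) * (n + m)) / (2 * (m : ℝ) ^ 2)) ^ ((1 : ℝ) / 3))
    (hr : r = Real.sqrt ((n : ℝ) * (n + 2 * m)) / (Real.sqrt 2 * b * m))
    (hq : q ^ 2 = ((n : ℝ) - m) / n)
    (hp2 : p ^ 2 = ((n : ℝ) ^ 2 - (m : ℝ) ^ 2) / ((n : ℝ) * (n + 2 * m)))
    (hp0 : 0 ≤ p ^ 2) (hp1 : p ^ 2 < 1)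
    (sn cn dn : ℝ → ℝ) (hJ : IsJacobiSystem p sn cn dn) :
    (Real.sqrt 2 * m * b * Real.pi / 3) *
        ∫ x in (0:ℝ)..(4 * ellipticK p / r), b * (1 - q ^ 2 * sn (r * x) ^ 2) =
      (4 * Real.pi * Real.sqrt n / (3 * Real.sqrt ((n : ℝ) + 2 * m))) *
        (((n : ℝ) + 2 * m) * ellipticE p - m * ellipticK p) := by
  have hm' : (0 : ℝ) < m := by exact_mod_cast hm
  have hmn' : (m : ℝ) < n := by exact_mod_cast hmn
  have hn' : (0 : ℝ) < n := hm'.trans hmn'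
  have hb_pos : 0 < b := hb ▸ by positivity
  have hb_cube : b ^ 3 = (n : ℝ) * (n + m) / (2 * (m : ℝ) ^ 2) := by
    rw [hb, ← Real.rpow_natCast, ← Real.rpow_mul (by positivity)]
    norm_num
  have hr_pos : 0 < r := hr ▸ by positivity
  have hqp : q ^ 2 = ((n : ℝ) + 2 * m) / (n + m) * p ^ 2 := by
    rw [hq, hp2]
    field_simp
    ring
  have hsn : ∫ x in (0:ℝ)..(4 * ellipticK p), b * (1 - q ^ 2 * sn x ^ 2) =
      b * (4 * (((n : ℝ) + 2 * m) * ellipticE p - m * ellipticK p) / (n + m)) := by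
    have hint : IntervalIntegrable (fun x => q ^ 2 * sn x ^ 2) MeasureTheory.volume
        0 (4 * ellipticK p) :=
      ((hJ.continuous_sn.pow 2).const_mul (q ^ 2)).intervalIntegrable _ _
    rw [intervalIntegral.integral_const_mul,
      intervalIntegral.integral_sub intervalIntegrable_const hint,
      intervalIntegral.integral_const_mul, hqp, mul_assoc, hJ.integral_sn_sq hp1]
    simp only [intervalIntegral.integral_const, smul_eq_mul]
    field_simp
    ring
  rw [intervalIntegral.integral_comp_mul_left (fun x => b * (1 - q ^ 2 * sn x ^ 2)) hr_pos.ne',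
    mul_zero, mul_div_cancel₀ _ hr_pos.ne', hsn, smul_eq_mul, hr, Real.sqrt_mul hn'.le]
  have hs : 0 < Real.sqrt n := Real.sqrt_pos.2 hn'
  have ht : 0 < Real.sqrt ((n : ℝ) + 2 * m) := Real.sqrt_pos.2 (by positivity)
  have hs2 : Real.sqrt n ^ 2 = n := Real.sq_sqrt hn'.le
  have h22 : Real.sqrt 2 ^ 2 = 2 := Real.sq_sqrt zero_le_two
  have hb' : 2 * (m : ℝ) ^ 2 * b ^ 3 = n * (n + m) := by
    rw [hb_cube]
    field_simp
  generalize ((n : ℝ) + 2 * m) * ellipticE p - m * ellipticK p = A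
  field_simp
  rw [h22, hs2]
  linear_combination A * hb'
end

section
/- Let b > 1 be a real number and set q² = 1 − (1+√(1+8b³))/(4b³), r² = b − (1−√(1+8b³))/(4b²) (with q, r > 0) and p² = b·q²/r². Then 0 < q² < 1, so b·(1 − q²·sn(r·x)²) > 0 for every x, and the function u(x) = (1/2)·log(b·(1 − q²·sn(r·x)²)), where sn is the Jacobi elliptic function of modulus p, satisfies u''(x) + e^{2u(x)} − e^{−4u(x)} = 0 for all x ∈ ℝ, together with the initial conditions e^{2u(0)} = b and u'(0) = 0. (This is the explicit solution (5.5) of the conformal-factor ODE (5.4) for minimal Lagrangian surfaces of ℂP² admitting a Killing field.) -/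
theorem IsJacobiSystem.cn_sq {p : ℝ} {sn cn dn : ℝ → ℝ} (h : IsJacobiSystem p sn cn dn)
    (x : ℝ) : cn x ^ 2 = 1 - sn x ^ 2 := by
  have hd : ∀ y, HasDerivAt (fun y => cn y ^ 2 + sn y ^ 2) 0 y := fun y => by
    refine HasDerivAt.congr_deriv (((h.hasDerivAt_cn y).pow 2).add ((h.hasDerivAt_sn y).pow 2)) ?_
    push_cast
    ring
  have hc := is_const_of_deriv_eq_zero (fun y => (hd y).differentiableAt)
    (fun y => (hd y).deriv) x 0
  simp only [h.sn_zero, h.cn_zero] at hc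
  linarith

theorem IsJacobiSystem.dn_sq {p : ℝ} {sn cn dn : ℝ → ℝ} (h : IsJacobiSystem p sn cn dn)
    (x : ℝ) : dn x ^ 2 = 1 - p ^ 2 * sn x ^ 2 := by
  have hd : ∀ y, HasDerivAt (fun y => dn y ^ 2 + p ^ 2 * sn y ^ 2) 0 y := fun y => by
    refine HasDerivAt.congr_deriv (((h.hasDerivAt_dn y).pow 2).add (((h.hasDerivAt_sn y).pow 2).const_mul (p ^ 2))) ?_
    push_cast
    ring
  have hc := is_const_of_deriv_eq_zero (fun y => (hd y).differentiableAt)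
    (fun y => (hd y).deriv) x 0
  simp only [h.sn_zero, h.dn_zero] at hc
  linarith

/-- The derivative of `sn · cn · dn`. -/
theorem IsJacobiSystem.hasDerivAt_sn_mul_cn_mul_dn {p : ℝ} {sn cn dn : ℝ → ℝ}
    (h : IsJacobiSystem p sn cn dn) (x : ℝ) :
    HasDerivAt (fun y => sn y * cn y * dn y)
      ((1 - 2 * sn x ^ 2) * (1 - p ^ 2 * sn x ^ 2) - p ^ 2 * sn x ^ 2 * (1 - sn x ^ 2)) x := by
  refine HasDerivAt.congr_deriv (((h.hasDerivAt_sn x).mul (h.hasDerivAt_cn x)).mul (h.hasDerivAt_dn x)) ?_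
  dsimp only [Pi.mul_apply]
  linear_combination (dn x ^ 2 - p ^ 2 * sn x ^ 2) * h.cn_sq x
    + (1 - 2 * sn x ^ 2) * h.dn_sq x

/-- The explicit solution (5.5) of the conformal-factor ODE (5.4) for minimal Lagrangian
surfaces of `ℂP²` admitting a Killing field:
`e^{2u(x)} = b(1 − q² sn²(rx))` solves `u'' + e^{2u} − e^{−4u} = 0`, `e^{2u(0)} = b`,
`u'(0) = 0`. -/
theorem explicit_solution_of_conformal_ODE (b : ℝ) (hb : 1 < b)
    (q r p : ℝ)
    (hq2 : q ^ 2 = 1 - (1 + Real.sqrt (1 + 8 * b ^ 3)) / (4 * b ^ 3)) (hq0 : 0 ≤ q)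
    (hr2 : r ^ 2 = b - (1 - Real.sqrt (1 + 8 * b ^ 3)) / (4 * b ^ 2)) (hr0 : 0 < r)
    (hp2 : p ^ 2 = b * q ^ 2 / r ^ 2) (hp0 : 0 < p ^ 2) (hp1 : p ^ 2 < 1)
    (sn cn dn : ℝ → ℝ) (hJ : IsJacobiSystem p sn cn dn) :
    (0 < q ^ 2 ∧ q ^ 2 < 1) ∧
    (∀ x : ℝ, 0 < b * (1 - q ^ 2 * sn (r * x) ^ 2)) ∧
    (∀ u : ℝ → ℝ, (∀ x : ℝ, u x = (1 / 2) * Real.log (b * (1 - q ^ 2 * sn (r * x) ^ 2))) →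
      (∀ x : ℝ, deriv (deriv u) x + Real.exp (2 * u x) - Real.exp (-4 * u x) = 0) ∧
      Real.exp (2 * u 0) = b ∧ deriv u 0 = 0) := by
  have hb0 : 0 < b := by linarith
  have hw : Real.sqrt (1 + 8 * b ^ 3) ^ 2 = 1 + 8 * b ^ 3 := Real.sq_sqrt (by positivity)
  have hw0 := Real.sqrt_nonneg (1 + 8 * b ^ 3)
  set w := Real.sqrt (1 + 8 * b ^ 3)
  have ha : b * (1 - q ^ 2) = (1 + w) / (4 * b ^ 2) := by
    rw [hq2]
    field_simp
    ring
  have hm : b - r ^ 2 = (1 - w) / (4 * b ^ 2) := by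
    rw [hr2]
    ring
  have hsym : b * (b * (1 - q ^ 2) + (b - r ^ 2)) + b * (1 - q ^ 2) * (b - r ^ 2) = 0 := by
    rw [ha, hm]
    field_simp
    linear_combination -hw
  have hprod : 2 * b * (b * (1 - q ^ 2)) * (b - r ^ 2) = -1 := by
    rw [ha, hm]
    field_simp
    linear_combination -2 * hw
  have hp : r ^ 2 * p ^ 2 = b * q ^ 2 := by
    rw [hp2]
    field_simp
  have hq_pos : 0 < q ^ 2 := by
    have : 0 < b * q ^ 2 := hp ▸ by positivity
    exact pos_of_mul_pos_right this hb0.le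
  have hq_lt : q ^ 2 < 1 := by
    have : 0 < (1 + w) / (4 * b ^ 3) := by positivity
    linarith
  have hpos : ∀ x : ℝ, 0 < b * (1 - q ^ 2 * sn (r * x) ^ 2) := fun x => by
    have h1 : sn (r * x) ^ 2 ≤ 1 := by linarith [hJ.cn_sq (r * x), sq_nonneg (cn (r * x))]
    have h2 : q ^ 2 * sn (r * x) ^ 2 ≤ q ^ 2 := mul_le_of_le_one_right hq_pos.le h1
    exact mul_pos hb0 (by linarith)
  refine ⟨⟨hq_pos, hq_lt⟩, hpos, fun u hu => ?_⟩
  have hexp : ∀ x, Real.exp (2 * u x) = b * (1 - q ^ 2 * sn (r * x) ^ 2) := fun x => by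
    rw [hu, ← mul_assoc, mul_one_div_cancel two_ne_zero, one_mul, Real.exp_log (hpos x)]
  have hexp' : ∀ x, Real.exp (-4 * u x) = ((b * (1 - q ^ 2 * sn (r * x) ^ 2)) ^ 2)⁻¹ := fun x => by
    rw [← hexp, ← Real.exp_nat_mul, ← Real.exp_neg]
    congr 1
    push_cast
    ring
  have hlin : ∀ x, HasDerivAt (fun y => r * y) r x := fun x => by
    simpa using (hasDerivAt_id x).const_mul r
  have hv : ∀ x, HasDerivAt (fun y => b * (1 - q ^ 2 * sn (r * y) ^ 2))
      (2 * (-(b * q ^ 2 * r) * (sn (r * x) * cn (r * x) * dn (r * x)))) x := fun x => by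
    have hs : HasDerivAt (fun y => sn (r * y)) _ x := (hJ.hasDerivAt_sn (r * x)).comp x (hlin x)
    refine HasDerivAt.congr_deriv ((((hs.pow 2).const_mul (q ^ 2)).const_sub 1).const_mul b) ?_
    push_cast
    ring
  have hN : ∀ x, HasDerivAt (fun y => -(b * q ^ 2 * r) * (sn (r * y) * cn (r * y) * dn (r * y)))
      _ x := fun x =>
    ((hJ.hasDerivAt_sn_mul_cn_mul_dn (r * x)).comp x (hlin x)).const_mul (-(b * q ^ 2 * r))
  have hu' : deriv u = fun x => -(b * q ^ 2 * r) * (sn (r * x) * cn (r * x) * dn (r * x)) /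
      (b * (1 - q ^ 2 * sn (r * x) ^ 2)) := by
    funext x
    rw [funext hu, (((hv x).log (hpos x).ne').const_mul (1 / 2)).deriv]
    ring
  refine ⟨fun x => ?_, by simp [hexp, hJ.sn_zero], by simp [hu', hJ.sn_zero]⟩
  rw [hu', ((hN x).fun_div (hv x) (hpos x).ne').deriv, hexp, hexp']
  have hv0 := (hpos x).ne'
  have hN_sq : (-(b * q ^ 2 * r) * (sn (r * x) * cn (r * x) * dn (r * x))) ^ 2 =
      (b * q ^ 2) ^ 2 * sn (r * x) ^ 2 * (1 - sn (r * x) ^ 2) *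
        (r ^ 2 - b * q ^ 2 * sn (r * x) ^ 2) := by
    rw [← hp]
    have : (-(r ^ 2 * p ^ 2 * r) * (sn (r * x) * cn (r * x) * dn (r * x))) ^ 2 =
        (r ^ 2 * p ^ 2 * r) ^ 2 * (sn (r * x) ^ 2 * cn (r * x) ^ 2 * dn (r * x) ^ 2) := by ring
    rw [this, hJ.cn_sq, hJ.dn_sq]
    ring
  set N := -(b * q ^ 2 * r) * (sn (r * x) * cn (r * x) * dn (r * x))
  have hN' : -(b * q ^ 2 * r) * (((1 - 2 * sn (r * x) ^ 2) * (1 - p ^ 2 * sn (r * x) ^ 2) -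
      p ^ 2 * sn (r * x) ^ 2 * (1 - sn (r * x) ^ 2)) * r) =
      -(b * q ^ 2) * ((1 - 2 * sn (r * x) ^ 2) * (r ^ 2 - b * q ^ 2 * sn (r * x) ^ 2) -
        b * q ^ 2 * sn (r * x) ^ 2 * (1 - sn (r * x) ^ 2)) := by
    rw [← hp]
    ring
  rw [hN']
  set S := sn (r * x) ^ 2
  set v := b * (1 - q ^ 2 * S) with hvdef
  field_simp
  rw [hvdef]
  linear_combination -2 * hN_sq + b * (1 - q ^ 2 * S) * hsym - hprod
end

section
/- Let b ≥ 1 be a real number and let u : ℝ → ℝ be a twice differentiable function satisfying u''(x) + e^{2u(x)} − e^{−4u(x)} = 0 for all x ∈ ℝ, with e^{2u(0)} = b and u'(0) = 0. Then the function v = e^{2u} satisfies v''(x) + 6·v(x)·(v(x) − (1+2b³)/(3b²)) = 0 for all x ∈ ℝ. (This is the key identity showing that g₁ = e^{2u} − (1+2b³)/(3b²) is an eigenfunction of the Laplacian of K_{n,m} with eigenvalue 6, used in the proof of Proposition 5.2.) -/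
/-- Conservation of energy for `u'' + e^{2u} − e^{−4u} = 0`. -/
theorem energy_eq_energy_zero (u u' u'' : ℝ → ℝ)
    (hu : ∀ x : ℝ, HasDerivAt u (u' x) x)
    (hu' : ∀ x : ℝ, HasDerivAt u' (u'' x) x)
    (hode : ∀ x : ℝ, u'' x + Real.exp (2 * u x) - Real.exp (-4 * u x) = 0) (x : ℝ) :
    u' x ^ 2 + Real.exp (2 * u x) + Real.exp (-4 * u x) / 2 =
      u' 0 ^ 2 + Real.exp (2 * u 0) + Real.exp (-4 * u 0) / 2 := by
  have hE : ∀ y : ℝ, HasDerivAt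
      (fun y => u' y ^ 2 + Real.exp (2 * u y) + Real.exp (-4 * u y) / 2) 0 y := by
    intro y
    refine ((((hu' y).fun_pow 2).fun_add ((hu y).const_mul 2).exp).fun_add
      (((hu y).const_mul (-4)).exp.div_const 2)).congr_deriv ?_
    push_cast
    linear_combination (2 * u' y) * hode y
  exact is_const_of_deriv_eq_zero (fun y => (hE y).differentiableAt) (fun y => (hE y).deriv) x 0


/-- The key identity showing that `g₁ = e^{2u} − (1+2b³)/(3b²)` is an eigenfunction of the
Laplacian of `K_{n,m}` with eigenvalue `6` (used in the proof of Proposition 5.2):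
if `u'' + e^{2u} − e^{−4u} = 0` with `e^{2u(0)} = b`, `u'(0) = 0`, then `v = e^{2u}`
satisfies `v'' + 6v(v − (1+2b³)/(3b²)) = 0`. -/
theorem exp_two_u_eigen_identity (b : ℝ) (hb : 1 ≤ b) (u u' u'' : ℝ → ℝ)
    (hu : ∀ x : ℝ, HasDerivAt u (u' x) x)
    (hu' : ∀ x : ℝ, HasDerivAt u' (u'' x) x)
    (hode : ∀ x : ℝ, u'' x + Real.exp (2 * u x) - Real.exp (-4 * u x) = 0)
    (h0 : Real.exp (2 * u 0) = b) (h0' : u' 0 = 0) :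
    ∀ x : ℝ, deriv (deriv (fun y : ℝ => Real.exp (2 * u y))) x +
      6 * Real.exp (2 * u x) * (Real.exp (2 * u x) - (1 + 2 * b ^ 3) / (3 * b ^ 2)) = 0 := by
  intro x
  have hexp : ∀ t : ℝ, Real.exp (-4 * t) = (Real.exp (2 * t) ^ 2)⁻¹ := by
    intro t
    rw [← Real.exp_nat_mul, ← Real.exp_neg]
    congr 1
    push_cast
    ring
  have hv : ∀ y : ℝ, HasDerivAt (fun y => Real.exp (2 * u y))
      (Real.exp (2 * u y) * (2 * u' y)) y := fun y => ((hu y).const_mul 2).exp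
  have hderiv : deriv (fun y => Real.exp (2 * u y)) =
      fun y => Real.exp (2 * u y) * (2 * u' y) := funext fun y => (hv y).deriv
  rw [hderiv, ((hv x).fun_mul ((hu' x).const_mul 2)).deriv]
  have henergy := energy_eq_energy_zero u u' u'' hu hu' hode x
  rw [hexp (u 0), h0, h0'] at henergy
  have hb0 : b ≠ 0 := (zero_lt_one.trans_le hb).ne'
  have hconst : 6 * ((1 + 2 * b ^ 3) / (3 * b ^ 2)) = 4 * (b + (b ^ 2)⁻¹ / 2) := by
    field_simp
    ring
  linear_combination (2 * Real.exp (2 * u x)) * hode x +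
    (4 * Real.exp (2 * u x)) * henergy - Real.exp (2 * u x) * hconst
end

section
/- Let b > 1 be a real number and set q² = 1 − (1+√(1+8b³))/(4b³), r² = b − (1−√(1+8b³))/(4b²) and p² = b·q²/r². Then for all x ∈ ℝ: r²·(−sn(r·x)·dn(r·x)² − p²·sn(r·x)·cn(r·x)²) + 2b·(1 − q²·sn(r·x)²)·sn(r·x) − sn(r·x)/(2b²) = 0, where sn, cn, dn are the Jacobi elliptic functions of modulus p (the first term is r² times the second derivative of x ↦ sn(r·x)). (This identity says that f(x,y) = sn(r·x) satisfies Δf = −2f + e^{−2u}f/(2b²) on the Klein bottle K_{n,m}, the central computation in the proof of Proposition 5.3(1).) -/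
theorem IsJacobiSystem.sn_sq_add_cn_sq_s5 {p : ℝ} {sn cn dn : ℝ → ℝ}
    (h : IsJacobiSystem p sn cn dn) (x : ℝ) : sn x ^ 2 + cn x ^ 2 = 1 := by
  have hd : ∀ y, HasDerivAt (fun y => sn y ^ 2 + cn y ^ 2) 0 y := fun y => by
    refine (((h.hasDerivAt_sn y).fun_pow 2).fun_add
      ((h.hasDerivAt_cn y).fun_pow 2)).congr_deriv ?_
    push_cast
    ring
  have hc := is_const_of_deriv_eq_zero (fun y => (hd y).differentiableAt)
    (fun y => (hd y).deriv) x 0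
  simpa [h.sn_zero, h.cn_zero] using hc

theorem IsJacobiSystem.dn_sq_add_sq_mul_sn_sq {p : ℝ} {sn cn dn : ℝ → ℝ}
    (h : IsJacobiSystem p sn cn dn) (x : ℝ) : dn x ^ 2 + p ^ 2 * sn x ^ 2 = 1 := by
  have hd : ∀ y, HasDerivAt (fun y => dn y ^ 2 + p ^ 2 * sn y ^ 2) 0 y := fun y => by
    refine (((h.hasDerivAt_dn y).fun_pow 2).fun_add
      (((h.hasDerivAt_sn y).fun_pow 2).const_mul (p ^ 2))).congr_deriv ?_
    push_cast
    ring
  have hc := is_const_of_deriv_eq_zero (fun y => (hd y).differentiableAt)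
    (fun y => (hd y).deriv) x 0
  simpa [h.sn_zero, h.dn_zero] using hc

/-- The central computation in the proof of Proposition 5.3(1): the identity saying that
`f(x,y) = sn(rx)` satisfies `Δf = −2f + e^{−2u} f/(2b²)` on the Klein bottle `K_{n,m}`. -/
theorem sn_laplacian_identity (b : ℝ) (hb : 1 < b)
    (q r p : ℝ)
    (hq2 : q ^ 2 = 1 - (1 + Real.sqrt (1 + 8 * b ^ 3)) / (4 * b ^ 3))
    (hr2 : r ^ 2 = b - (1 - Real.sqrt (1 + 8 * b ^ 3)) / (4 * b ^ 2))
    (hp2 : p ^ 2 = b * q ^ 2 / r ^ 2)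
    (sn cn dn : ℝ → ℝ) (hJ : IsJacobiSystem p sn cn dn) :
    ∀ x : ℝ,
      r ^ 2 * (-(sn (r * x)) * dn (r * x) ^ 2 - p ^ 2 * sn (r * x) * cn (r * x) ^ 2) +
        2 * b * (1 - q ^ 2 * sn (r * x) ^ 2) * sn (r * x) - sn (r * x) / (2 * b ^ 2) = 0 := by
  intro x
  have hb0 : 0 < b := by linarith
  have hS : 1 ≤ √(1 + 8 * b ^ 3) := Real.one_le_sqrt.mpr (by nlinarith [pow_pos hb0 3])
  have hr : 0 < r ^ 2 := by
    have : (1 - √(1 + 8 * b ^ 3)) / (4 * b ^ 2) ≤ 0 :=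
      div_nonpos_of_nonpos_of_nonneg (by linarith) (by positivity)
    rw [hr2]
    linarith
  have hrp : r ^ 2 * p ^ 2 = b * q ^ 2 := by
    rw [hp2, mul_div_cancel₀ _ hr.ne']
  have hsum : r ^ 2 + b * q ^ 2 = 2 * b - 1 / (2 * b ^ 2) := by
    rw [hq2, hr2]
    field_simp
    ring
  have hcn := hJ.sn_sq_add_cn_sq_s5 (r * x)
  have hdn := hJ.dn_sq_add_sq_mul_sn_sq (r * x)
  have hdiv : sn (r * x) / (2 * b ^ 2) = sn (r * x) * (1 / (2 * b ^ 2)) := by ring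
  rw [hdiv]
  linear_combination (-(r ^ 2 * sn (r * x))) * hdn - r ^ 2 * p ^ 2 * sn (r * x) * hcn
    - sn (r * x) * hsum + (2 * sn (r * x) ^ 3 - sn (r * x)) * hrp
end
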